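/- arXiv:1806.01635 — 4 statements merged into one kernel-verified Lean document; each statement's English description precedes it below -/
import Mathlib

section
/- Let ω = (ω₁, ω₂) be irrational. Then a 4-tuple (k₁, k₂, k₃, k₄) ∈ (ℤ²)⁴ belongs to the resonance set R if and only if for each coordinate i ∈ {1, 2}: either (k₁⁽ⁱ⁾ = k₃⁽ⁱ⁾ and k₂⁽ⁱ⁾ = k₄⁽ⁱ⁾) or (k₁⁽ⁱ⁾ = k₄⁽ⁱ⁾ and k₂⁽ⁱ⁾ = k₃⁽ⁱ⁾). -/
/-- `ω = (ω₁, ω₂)` is irrational: `ω₁m₁ + ω₂m₂ ≠ 0` for every nonzero `(m₁, m₂) ∈ ℤ²`. -/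
def IsIrrationalPair (ω : ℝ × ℝ) : Prop :=
  ∀ m : ℤ × ℤ, m ≠ 0 → ω.1 * (m.1 : ℝ) + ω.2 * (m.2 : ℝ) ≠ 0

/-- The frequency `λ_k = ω₁(k⁽¹⁾)² + ω₂(k⁽²⁾)²` for `k ∈ ℤ²`. -/
noncomputable def freq (ω : ℝ × ℝ) (k : ℤ × ℤ) : ℝ :=
  ω.1 * (k.1 : ℝ) ^ 2 + ω.2 * (k.2 : ℝ) ^ 2

/-- Membership in the resonance set `R`: conservation of momentum and of the
linear energy. -/
def InRes (ω : ℝ × ℝ) (k₁ k₂ k₃ k₄ : ℤ × ℤ) : Prop :=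
  k₁ + k₂ = k₃ + k₄ ∧ freq ω k₁ + freq ω k₂ = freq ω k₃ + freq ω k₄

/-- Two pairs of elements of an integral domain in which `2 ≠ 0` have the same sum and the same
sum of squares iff they agree up to order. -/
theorem add_eq_add_and_sq_add_sq_eq_iff {R : Type*} [CommRing R] [IsDomain R] (h2 : (2 : R) ≠ 0)
    {a b c d : R} :
    (a + b = c + d ∧ a ^ 2 + b ^ 2 = c ^ 2 + d ^ 2) ↔
      (a = c ∧ b = d) ∨ (a = d ∧ b = c) := by
  constructor
  · rintro ⟨hs, hq⟩
    have hprod : (a - c) * (a - d) = 0 := by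
      refine (mul_eq_zero.mp ?_).resolve_left h2
      linear_combination hq + (a - b - c - d) * hs
    rcases mul_eq_zero.mp hprod with h | h
    · exact Or.inl ⟨sub_eq_zero.mp h, by linear_combination hs - h⟩
    · exact Or.inr ⟨sub_eq_zero.mp h, by linear_combination hs - h⟩
  · rintro (⟨rfl, rfl⟩ | ⟨rfl, rfl⟩)
    · exact ⟨rfl, rfl⟩
    · exact ⟨add_comm _ _, add_comm _ _⟩

theorem IsIrrationalPair.mul_add_mul_eq_zero_iff {ω : ℝ × ℝ} (hω : IsIrrationalPair ω) {m n : ℤ} :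
    ω.1 * (m : ℝ) + ω.2 * (n : ℝ) = 0 ↔ m = 0 ∧ n = 0 := by
  refine ⟨fun h => ?_, by rintro ⟨rfl, rfl⟩; simp⟩
  by_contra hmn
  exact hω (m, n) (by simpa [Prod.ext_iff] using hmn) h

/-- For irrational `ω`, conservation of energy decouples into the two coordinates. -/
theorem IsIrrationalPair.freq_add_freq_eq_iff {ω : ℝ × ℝ} (hω : IsIrrationalPair ω)
    {k₁ k₂ k₃ k₄ : ℤ × ℤ} :
    freq ω k₁ + freq ω k₂ = freq ω k₃ + freq ω k₄ ↔
      k₁.1 ^ 2 + k₂.1 ^ 2 = k₃.1 ^ 2 + k₄.1 ^ 2 ∧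
        k₁.2 ^ 2 + k₂.2 ^ 2 = k₃.2 ^ 2 + k₄.2 ^ 2 := by
  rw [← sub_eq_zero, ← sub_eq_zero (a := k₁.1 ^ 2 + k₂.1 ^ 2),
    ← sub_eq_zero (a := k₁.2 ^ 2 + k₂.2 ^ 2), ← hω.mul_add_mul_eq_zero_iff]
  refine Eq.congr_left ?_
  simp only [freq]
  push_cast
  ring

/-- For irrational `ω`, `(k₁, k₂, k₃, k₄) ∈ R` iff in each coordinate `i ∈ {1,2}`
either `k₁⁽ⁱ⁾ = k₃⁽ⁱ⁾ ∧ k₂⁽ⁱ⁾ = k₄⁽ⁱ⁾` or `k₁⁽ⁱ⁾ = k₄⁽ⁱ⁾ ∧ k₂⁽ⁱ⁾ = k₃⁽ⁱ⁾`. -/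
theorem stmt_2 (ω : ℝ × ℝ) (hω1 : 0 < ω.1) (hω2 : 0 < ω.2)
    (hirr : IsIrrationalPair ω) (k₁ k₂ k₃ k₄ : ℤ × ℤ) :
    InRes ω k₁ k₂ k₃ k₄ ↔
      ((k₁.1 = k₃.1 ∧ k₂.1 = k₄.1) ∨ (k₁.1 = k₄.1 ∧ k₂.1 = k₃.1)) ∧
      ((k₁.2 = k₃.2 ∧ k₂.2 = k₄.2) ∨ (k₁.2 = k₄.2 ∧ k₂.2 = k₃.2)) := by
  rw [InRes, hirr.freq_add_freq_eq_iff, Prod.ext_iff, Prod.fst_add, Prod.fst_add, Prod.snd_add,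
    Prod.snd_add, and_and_and_comm, add_eq_add_and_sq_add_sq_eq_iff two_ne_zero,
    add_eq_add_and_sq_add_sq_eq_iff two_ne_zero]
end

section
/- Let ω = (ω₁, ω₂) be irrational and k = (k⁽¹⁾, k⁽²⁾) ∈ ℤ². Then a triple (k₁, k₂, k₃) ∈ (ℤ²)³ belongs to R(k) if and only if there exist a, b ∈ ℤ such that (k₁, k₂, k₃) is one of the following four triples: ((k⁽¹⁾, b), (a, k⁽²⁾), (a, b)); ((a, k⁽²⁾), (k⁽¹⁾, b), (a, b)); ((k⁽¹⁾, k⁽²⁾), (a, b), (a, b)); ((a, b), (k⁽¹⁾, k⁽²⁾), (a, b)). -/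
/-- `(k₁, k₂, k₃) ∈ R(k)` iff `(k₁, k₂, k₃, k) ∈ R`. -/
def InResAt (ω : ℝ × ℝ) (k k₁ k₂ k₃ : ℤ × ℤ) : Prop :=
  InRes ω k₁ k₂ k₃ k

/-- Two integers with the same sum and the same sum of squares as `p` and `x` are
`p` and `x` in some order. -/
lemma eq_and_eq_or_of_add_eq_of_sq_add_sq_eq {m n p x : ℤ} (h : m + n = p + x)
    (hsq : m ^ 2 + n ^ 2 = p ^ 2 + x ^ 2) : (m = x ∧ n = p) ∨ (n = x ∧ m = p) := by
  have hmul : (m - x) * (n - x) = 0 := by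
    obtain rfl : p = m + n - x := by lia
    linarith
  rcases mul_eq_zero.mp hmul with h0 | h0
  · left; lia
  · right; lia

/-- For an irrational pair, resonance of frequencies decouples into the two coordinates. -/
lemma IsIrrationalPair.sq_add_sq_eq {ω : ℝ × ℝ} (hirr : IsIrrationalPair ω)
    {k₁ k₂ k₃ k₄ : ℤ × ℤ} (h : freq ω k₁ + freq ω k₂ = freq ω k₃ + freq ω k₄) :
    k₁.1 ^ 2 + k₂.1 ^ 2 = k₃.1 ^ 2 + k₄.1 ^ 2 ∧
      k₁.2 ^ 2 + k₂.2 ^ 2 = k₃.2 ^ 2 + k₄.2 ^ 2 := by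
  have hm : (k₁.1 ^ 2 + k₂.1 ^ 2 - (k₃.1 ^ 2 + k₄.1 ^ 2),
      k₁.2 ^ 2 + k₂.2 ^ 2 - (k₃.2 ^ 2 + k₄.2 ^ 2)) = (0 : ℤ × ℤ) := by
    by_contra hne
    refine hirr _ hne ?_
    unfold freq at h
    push_cast
    linarith
  simpa [Prod.ext_iff, sub_eq_zero] using hm

/-- For irrational `ω`, a triple `(k₁, k₂, k₃)` belongs to `R(k)` iff there are `a, b ∈ ℤ`
such that the triple has one of the four forms
`((k⁽¹⁾, b), (a, k⁽²⁾), (a, b))`, `((a, k⁽²⁾), (k⁽¹⁾, b), (a, b))`,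
`((k⁽¹⁾, k⁽²⁾), (a, b), (a, b))`, `((a, b), (k⁽¹⁾, k⁽²⁾), (a, b))`. -/
theorem stmt_3 (ω : ℝ × ℝ) (hω1 : 0 < ω.1) (hω2 : 0 < ω.2)
    (hirr : IsIrrationalPair ω) (k k₁ k₂ k₃ : ℤ × ℤ) :
    InResAt ω k k₁ k₂ k₃ ↔
      ∃ a b : ℤ,
        (k₁ = (k.1, b) ∧ k₂ = (a, k.2) ∧ k₃ = (a, b)) ∨
        (k₁ = (a, k.2) ∧ k₂ = (k.1, b) ∧ k₃ = (a, b)) ∨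
        (k₁ = (k.1, k.2) ∧ k₂ = (a, b) ∧ k₃ = (a, b)) ∨
        (k₁ = (a, b) ∧ k₂ = (k.1, k.2) ∧ k₃ = (a, b)) := by
  constructor
  · rintro ⟨hsum, hfreq⟩
    obtain ⟨hsq₁, hsq₂⟩ := hirr.sq_add_sq_eq hfreq
    obtain ⟨hsum₁, hsum₂⟩ := Prod.ext_iff.mp hsum
    refine ⟨k₃.1, k₃.2, ?_⟩
    have h₁ := eq_and_eq_or_of_add_eq_of_sq_add_sq_eq hsum₁ hsq₁
    have h₂ := eq_and_eq_or_of_add_eq_of_sq_add_sq_eq hsum₂ hsq₂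
    simp only [Prod.ext_iff]
    tauto
  · rintro ⟨a, b, ⟨rfl, rfl, rfl⟩ | ⟨rfl, rfl, rfl⟩ | ⟨rfl, rfl, rfl⟩ | ⟨rfl, rfl, rfl⟩⟩ <;>
      refine ⟨by ext <;> simp [add_comm], ?_⟩ <;> simp only [freq] <;> ring
end

section
/- Let ω = (ω₁, ω₂) be irrational and k = (k⁽¹⁾, k⁽²⁾) ∈ ℤ². Then for every triple (k₁, k₂, k₃) ∈ R(k) there exist indices i, j ∈ {1, 2, 3} such that k_i⁽¹⁾ = k⁽¹⁾ and k_j⁽²⁾ = k⁽²⁾. -/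
/-- Two integers are determined, up to order, by their sum and their sum of squares. -/
lemma eq_or_eq_of_add_eq_add_of_sq_add_sq {a b c d : ℤ} (h : a + b = c + d)
    (hsq : a ^ 2 + b ^ 2 - c ^ 2 - d ^ 2 = 0) : a = d ∨ b = d := by
  have hprod : (a - d) * (b - d) = 0 := by
    obtain rfl : c = a + b - d := by lia
    linarith
  rcases mul_eq_zero.mp hprod with h' | h'
  · exact Or.inl (sub_eq_zero.mp h')
  · exact Or.inr (sub_eq_zero.mp h')

/-- For irrational `ω` the resonance condition on the frequencies decouples into one
condition per coordinate. -/
lemma IsIrrationalPair.sq_eq_zero_of_freq_eq {ω : ℝ × ℝ} (hirr : IsIrrationalPair ω)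
    {k₁ k₂ k₃ k₄ : ℤ × ℤ} (h : freq ω k₁ + freq ω k₂ = freq ω k₃ + freq ω k₄) :
    k₁.1 ^ 2 + k₂.1 ^ 2 - k₃.1 ^ 2 - k₄.1 ^ 2 = 0 ∧
      k₁.2 ^ 2 + k₂.2 ^ 2 - k₃.2 ^ 2 - k₄.2 ^ 2 = 0 := by
  by_contra hne
  refine hirr (k₁.1 ^ 2 + k₂.1 ^ 2 - k₃.1 ^ 2 - k₄.1 ^ 2,
    k₁.2 ^ 2 + k₂.2 ^ 2 - k₃.2 ^ 2 - k₄.2 ^ 2) (fun h0 => hne (Prod.mk.inj h0)) ?_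
  unfold freq at h
  push_cast
  linarith

/-- For irrational `ω` and every `(k₁, k₂, k₃) ∈ R(k)` there are indices `i, j ∈ {1,2,3}`
with `k_i⁽¹⁾ = k⁽¹⁾` and `k_j⁽²⁾ = k⁽²⁾`. -/
theorem stmt_4 (ω : ℝ × ℝ) (hω1 : 0 < ω.1) (hω2 : 0 < ω.2)
    (hirr : IsIrrationalPair ω) (k k₁ k₂ k₃ : ℤ × ℤ)
    (h : InResAt ω k k₁ k₂ k₃) :
    ∃ i j : Fin 3, (![k₁, k₂, k₃] i).1 = k.1 ∧ (![k₁, k₂, k₃] j).2 = k.2 := by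
  obtain ⟨hsum, hfreq⟩ := h
  obtain ⟨hsq₁, hsq₂⟩ := hirr.sq_eq_zero_of_freq_eq hfreq
  obtain ⟨hsum₁, hsum₂⟩ := Prod.ext_iff.mp hsum
  have hi : ∃ i : Fin 3, (![k₁, k₂, k₃] i).1 = k.1 :=
    (eq_or_eq_of_add_eq_add_of_sq_add_sq hsum₁ hsq₁).elim (fun e => ⟨0, e⟩) (fun e => ⟨1, e⟩)
  have hj : ∃ j : Fin 3, (![k₁, k₂, k₃] j).2 = k.2 :=
    (eq_or_eq_of_add_eq_add_of_sq_add_sq hsum₂ hsq₂).elim (fun e => ⟨0, e⟩) (fun e => ⟨1, e⟩)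
  obtain ⟨i, hi⟩ := hi
  obtain ⟨j, hj⟩ := hj
  exact ⟨i, j, hi, hj⟩
end

section
/- Let I be a finite set, a, b : I → ℝ, let τ, σ : I → I be bijections, and let s ≥ 1 be a real number. Then ∑_{i ∈ I} (a_i² + b_{τ(i)}²)^s ≤ 2^s · ∑_{i ∈ I} (a_i² + b_{σ(i)}²)^s. -/
open Real

/-- A crude convexity bound for real powers of a sum of two nonnegative reals. -/
theorem add_rpow_le_two_rpow_mul {x y s : ℝ} (hx : 0 ≤ x) (hy : 0 ≤ y) (hs : 0 ≤ s) :
    (x + y) ^ s ≤ 2 ^ s * (x ^ s + y ^ s) := by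
  wlog h : x ≤ y generalizing x y
  · rw [add_comm x y, add_comm (x ^ s)]
    exact this hy hx (le_of_not_ge h)
  calc (x + y) ^ s ≤ (2 * y) ^ s := Real.rpow_le_rpow (by positivity) (by linarith) hs
    _ = 2 ^ s * y ^ s := Real.mul_rpow (by norm_num) hy
    _ ≤ 2 ^ s * (x ^ s + y ^ s) := by
      gcongr
      exact le_add_of_nonneg_left (Real.rpow_nonneg hx s)

/-- For a finite index set `I`, reals `a, b : I → ℝ`, bijections `τ, σ : I → I` and a
real `s ≥ 1`, one has `∑ᵢ (aᵢ² + b_{τ(i)}²)^s ≤ 2^s · ∑ᵢ (aᵢ² + b_{σ(i)}²)^s`. -/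
theorem stmt_9 {I : Type*} [Fintype I] (a b : I → ℝ) (τ σ : Equiv.Perm I)
    (s : ℝ) (hs : 1 ≤ s) :
    ∑ i : I, ((a i) ^ 2 + (b (τ i)) ^ 2) ^ s ≤
      (2 : ℝ) ^ s * ∑ i : I, ((a i) ^ 2 + (b (σ i)) ^ 2) ^ s := by
  calc ∑ i : I, ((a i) ^ 2 + (b (τ i)) ^ 2) ^ s
      ≤ ∑ i : I, (2 : ℝ) ^ s * (((a i) ^ 2) ^ s + ((b (τ i)) ^ 2) ^ s) :=
        Finset.sum_le_sum fun i _ =>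
          add_rpow_le_two_rpow_mul (sq_nonneg _) (sq_nonneg _) (by linarith)
    _ = (2 : ℝ) ^ s * ∑ i : I, (((a i) ^ 2) ^ s + ((b (σ i)) ^ 2) ^ s) := by
        rw [← Finset.mul_sum, Finset.sum_add_distrib, Finset.sum_add_distrib,
          Equiv.sum_comp τ fun i => ((b i) ^ 2) ^ s, Equiv.sum_comp σ fun i => ((b i) ^ 2) ^ s]
    _ ≤ (2 : ℝ) ^ s * ∑ i : I, ((a i) ^ 2 + (b (σ i)) ^ 2) ^ s := by
        gcongr with i
        exact Real.add_rpow_le_rpow_add (sq_nonneg _) (sq_nonneg _) hs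
end
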